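/- For 0 ≤ i ≤ n, the dual Bernstein polynomials satisfy x d/dx D^n_i(x; α, β) + (i+β+1) D^n_i(x; α, β) = [i(n-i+α+1)/(n-i+1)] D^n_{i-1}(x; α, β) + A^{(α,β)}_{ni} [(n+β+1)/(n-i+1)] R^{(α+1,β)}_n(x), where A^{(α,β)}_{ni} = (-1)^{n-i}(n+1)(σ+1)_n / (K (α+1)_{n-i} (β+1)_i), σ = α+β+1, K = Γ(α+1)Γ(β+1)/Γ(σ+1), and D^n_{-1} := 0. -/

import Mathlib

open scoped BigOperators
open MeasureTheory Polynomial

/-- Pochhammer symbol `(c)_l = c (c+1) ⋯ (c+l-1)`. -/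
noncomputable def poch (c : ℝ) (l : ℕ) : ℝ := ∏ j ∈ Finset.range l, (c + j)

/-- Shifted Jacobi polynomial `R_k^{(α,β)}(x)`. -/
noncomputable def jacobiR (α β : ℝ) (k : ℕ) (x : ℝ) : ℝ :=
  poch (α + 1) k / (Nat.factorial k) *
    ∑ l ∈ Finset.range (k + 1),
      poch (-(k : ℝ)) l * poch ((k : ℝ) + α + β + 1) l /
        (poch (α + 1) l * (Nat.factorial l)) * (1 - x) ^ l

/-- Hahn polynomial `Q_k(x; α, β; N)`. -/
noncomputable def hahnQ (α β : ℝ) (N k : ℕ) (x : ℝ) : ℝ :=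
  ∑ l ∈ Finset.range (k + 1),
    poch (-(k : ℝ)) l * poch ((k : ℝ) + α + β + 1) l * poch (-x) l /
      (poch (α + 1) l * poch (-(N : ℝ)) l * (Nat.factorial l))

/-- Bernstein basis polynomial `B^n_i(x)` as a real function. -/
noncomputable def bern (n i : ℕ) (x : ℝ) : ℝ :=
  (n.choose i : ℝ) * x ^ i * (1 - x) ^ (n - i)

/-- `D 0, …, D n` are the dual Bernstein polynomials of degree `n` with
parameters `α, β`: they have degree at most `n` and are biorthogonal to the
Bernstein basis w.r.t. the weight `(1-x)^α x^β` on `[0,1]`. -/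
def IsDualBernstein (n : ℕ) (α β : ℝ) (D : ℕ → Polynomial ℝ) : Prop :=
  (∀ j, j ≤ n → (D j).natDegree ≤ n) ∧
  ∀ i, i ≤ n → ∀ j, j ≤ n →
    (∫ x in (0:ℝ)..1, (1 - x) ^ α * x ^ β * bern n i x * (D j).eval x)
      = if i = j then (1:ℝ) else 0


lemma poch_succ (c : ℝ) (l : ℕ) : poch c (l+1) = poch c l * (c + l) := by
  simp [poch, Finset.prod_range_succ]

lemma poch_zero (c : ℝ) : poch c 0 = 1 := by simp [poch]

lemma poch_pos {c : ℝ} (hc : 0 < c) (l : ℕ) : 0 < poch c l := by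
  unfold poch; exact Finset.prod_pos (fun j _ => by positivity)

lemma poch_add (c : ℝ) (k l : ℕ) : poch c (k + l) = poch c k * poch (c + k) l := by
  induction l with
  | zero => simp [poch_zero]
  | succ l ih => rw [← add_assoc, poch_succ, poch_succ, ih]; push_cast; ring

lemma Gamma_poch {c : ℝ} (hc : 0 < c) (l : ℕ) :
    Real.Gamma (c + l) = poch c l * Real.Gamma c := by
  induction l with
  | zero => simp [poch_zero]
  | succ l ih =>
    have : c + ((l+1 : ℕ) : ℝ) = (c + l) + 1 := by push_cast; ring
    rw [this, Real.Gamma_add_one (by positivity), ih, poch_succ]; ring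

lemma poch_neg (n l : ℕ) (hl : l ≤ n) :
    poch (-(n:ℝ)) l = (-1)^l * (n.choose l : ℝ) * (l.factorial : ℝ) := by
  induction l with
  | zero => simp [poch_zero]
  | succ l ih =>
    rw [poch_succ, ih (by omega), Nat.factorial_succ]
    have h := Nat.choose_succ_right_eq n l
    have h2 : (n.choose (l+1) : ℝ) * (l+1) = n.choose l * ((n:ℝ) - l) := by
      rw [← Nat.cast_sub (by omega)]; exact_mod_cast h
    push_cast
    linear_combination (-1)^l * (l.factorial:ℝ) * h2

lemma beta_integrable {a b : ℝ} (ha : a > -1) (hb : b > -1) :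
    IntervalIntegrable (fun x : ℝ => (1 - x)^a * x^b) volume 0 1 := by
  have h := Complex.betaIntegral_convergent (u := ((b+1 : ℝ) : ℂ)) (v := ((a+1:ℝ) : ℂ))
    (by simp; linarith) (by simp; linarith)
  have h2 : IntervalIntegrable (fun x : ℝ => (((x : ℂ) ^ (((b+1 : ℝ) : ℂ) - 1) * (1 - (x : ℂ)) ^ (((a+1:ℝ) : ℂ) - 1))).re) volume 0 1 := by
    rw [intervalIntegrable_iff] at h ⊢
    exact h.re
  refine h2.congr ?_
  intro x hx
  rw [Set.uIoc_of_le zero_le_one] at hx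
  have e1 : (((b+1 : ℝ) : ℂ) - 1) = (b : ℂ) := by push_cast; ring
  have e2 : (((a+1 : ℝ) : ℂ) - 1) = (a : ℂ) := by push_cast; ring
  have e3 : (1 - (x:ℂ)) = ((1 - x : ℝ) : ℂ) := by push_cast; ring
  simp only [e1, e2, e3]
  rw [← Complex.ofReal_cpow hx.1.le, ← Complex.ofReal_cpow (by linarith [hx.2]), ← Complex.ofReal_mul, Complex.ofReal_re, mul_comm]

lemma beta_value {a b : ℝ} (ha : a > -1) (hb : b > -1) :
    (∫ x in (0:ℝ)..1, (1 - x)^a * x^b) =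
      Real.Gamma (a+1) * Real.Gamma (b+1) / Real.Gamma (a + b + 2) := by
  have h := ProbabilityTheory.beta_eq_betaIntegralReal (b+1) (a+1) (by linarith) (by linarith)
  have h3 : Complex.betaIntegral ((b+1:ℝ):ℂ) ((a+1:ℝ):ℂ) = ((∫ x in (0:ℝ)..1, (1 - x)^a * x^b : ℝ) : ℂ) := by
    rw [Complex.betaIntegral, ← intervalIntegral.integral_ofReal]
    apply intervalIntegral.integral_congr
    intro x hx
    rw [Set.uIcc_of_le zero_le_one] at hx
    have e1 : (((b+1 : ℝ) : ℂ) - 1) = (b : ℂ) := by push_cast; ring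
    have e2 : (((a+1 : ℝ) : ℂ) - 1) = (a : ℂ) := by push_cast; ring
    have e3 : (1 - (x:ℂ)) = ((1 - x : ℝ) : ℂ) := by push_cast; ring
    simp only [e1, e2, e3]
    rw [← Complex.ofReal_cpow hx.1, ← Complex.ofReal_cpow (by linarith [hx.2]), ← Complex.ofReal_mul, mul_comm]
  rw [h3, Complex.ofReal_re] at h
  rw [← h, ProbabilityTheory.beta]
  rw [show b + 1 + (a + 1) = a + b + 2 by ring, mul_comm (Real.Gamma (b+1))]

lemma wint_integrable {a b : ℝ} (ha : a > -1) (hb : b > -1) (p : ℝ[X]) :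
    IntervalIntegrable (fun x : ℝ => (1 - x)^a * x^b * p.eval x) volume 0 1 :=
  (beta_integrable ha hb).mul_continuousOn p.continuous.continuousOn

noncomputable def wI (a b : ℝ) (p : ℝ[X]) : ℝ :=
  ∫ x in (0:ℝ)..1, (1 - x)^a * x^b * p.eval x

lemma wI_add {a b : ℝ} (ha : a > -1) (hb : b > -1) (p q : ℝ[X]) : wI a b (p + q) = wI a b p + wI a b q := by
  unfold wI
  rw [← intervalIntegral.integral_add (wint_integrable ha hb p) (wint_integrable ha hb q)]
  congr 1; ext x; rw [eval_add]; ring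

lemma wI_C_mul {a b : ℝ} (c : ℝ) (p : ℝ[X]) : wI a b (C c * p) = c * wI a b p := by
  unfold wI
  rw [← intervalIntegral.integral_const_mul]
  congr 1; ext x; rw [eval_mul, eval_C]; ring

lemma wI_sub {a b : ℝ} (ha : a > -1) (hb : b > -1) (p q : ℝ[X]) : wI a b (p - q) = wI a b p - wI a b q := by
  have := wI_add ha hb p (C (-1) * q)
  rw [wI_C_mul] at this
  rw [show p - q = p + C (-1) * q by simp [sub_eq_add_neg], this]; ring

lemma wI_sum {a b : ℝ} (ha : a > -1) (hb : b > -1) (s : Finset ℕ) (f : ℕ → ℝ[X]) : wI a b (∑ j ∈ s, f j) = ∑ j ∈ s, wI a b (f j) := by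
  classical
  induction s using Finset.induction_on with
  | empty => simp [wI]
  | insert i s hi ih => rw [Finset.sum_insert hi, Finset.sum_insert hi, wI_add ha hb, ih]

lemma wI_monomial {a b : ℝ} (ha : a > -1) (hb : b > -1) (j k : ℕ) : wI a b (X^j * (1-X)^k) =
    Real.Gamma (a+1) * Real.Gamma (b+1) * poch (a+1) k * poch (b+1) j / Real.Gamma (a+b+2+(j+k:ℕ)) := by
  have h := beta_value (a := a + k) (b := b + j) (by have := k.cast_nonneg (α := ℝ); linarith) (by have := j.cast_nonneg (α := ℝ); linarith)
  have e : wI a b (X^j * (1-X)^k) = ∫ x in (0:ℝ)..1, (1 - x)^(a+k) * x^(b+j) := by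
    unfold wI
    rw [intervalIntegral.integral_of_le zero_le_one, intervalIntegral.integral_of_le zero_le_one,
      integral_Ioc_eq_integral_Ioo, integral_Ioc_eq_integral_Ioo]
    apply setIntegral_congr_fun measurableSet_Ioo
    intro x hx
    simp only [eval_mul, eval_pow, eval_X, eval_sub, eval_one]
    rw [Real.rpow_add_natCast (by linarith [hx.2]), Real.rpow_add_natCast (by linarith [hx.1])]
    ring
  rw [e, h, show a + k + 1 = (a + 1) + k by ring, show b + j + 1 = (b + 1) + j by ring,
    Gamma_poch (by linarith), Gamma_poch (by linarith)]
  congr 1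
  · ring
  · congr 1; push_cast; ring

lemma wI_eq_zero {a b : ℝ} (ha : a > -1) (hb : b > -1) (p : ℝ[X]) (h : wI a b (p * p) = 0) : p = 0 := by
  by_contra hp
  unfold wI at h
  rw [intervalIntegral.integral_of_le zero_le_one] at h
  have hi := (wint_integrable ha hb (p*p))
  rw [intervalIntegrable_iff, Set.uIoc_of_le zero_le_one] at hi
  rw [integral_Ioc_eq_integral_Ioo] at h
  have hi2 := hi.mono_set Set.Ioo_subset_Ioc_self
  rw [setIntegral_eq_zero_iff_of_nonneg_ae ?_ hi2] at h
  · have h2 : ∀ᵐ x ∂(volume.restrict (Set.Ioo (0:ℝ) 1)), False := by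
      have h3 : ∀ᵐ x ∂(volume : Measure ℝ), x ∉ (p.roots.toFinset : Set ℝ) := by
        exact (Finset.countable_toSet _).ae_notMem _
      filter_upwards [h, ae_restrict_of_ae h3, ae_restrict_mem measurableSet_Ioo] with x hx hx3 hx4
      apply hx3
      simp only [eval_mul, Pi.zero_apply, mul_eq_zero, or_self] at hx
      have := Real.rpow_pos_of_pos hx4.1 b
      have := Real.rpow_pos_of_pos (show 0 < 1 - x by linarith [hx4.2]) a
      simp [hp]
      rcases hx with (hx | hx) | hx
      · linarith
      · linarith
      · exact hx
    have := Filter.eventually_false_iff_eq_bot.mp h2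
    rw [ae_eq_bot, Measure.restrict_eq_zero] at this
    simp at this
  · filter_upwards [ae_restrict_mem measurableSet_Ioo] with x hx
    have := Real.rpow_pos_of_pos hx.1 b
    have := Real.rpow_pos_of_pos (show 0 < 1 - x by linarith [hx.2]) a
    simp only [eval_mul, Pi.zero_apply]
    have := mul_self_nonneg (p.eval x)
    positivity


lemma wI_succ {a b : ℝ} (p : ℝ[X]) :
    wI (a+1) b p = wI a b ((1-X)*p) := by
  unfold wI
  rw [intervalIntegral.integral_of_le zero_le_one, intervalIntegral.integral_of_le zero_le_one,
      integral_Ioc_eq_integral_Ioo, integral_Ioc_eq_integral_Ioo]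
  apply setIntegral_congr_fun measurableSet_Ioo
  intro x hx
  simp only [eval_mul, eval_X, eval_sub, eval_one]
  rw [Real.rpow_add_one (by linarith [hx.2])]
  ring

noncomputable def pochPoly (c : ℝ) (m : ℕ) : ℝ[X] := ∏ j ∈ Finset.range m, (X + C (c + j))

lemma pochPoly_eval (c : ℝ) (m : ℕ) (y : ℝ) : (pochPoly c m).eval y = poch (c + y) m := by
  simp only [pochPoly, poch, eval_prod, eval_add, eval_X, eval_C]
  exact Finset.prod_congr rfl (fun j _ => by ring)

lemma pochPoly_monic (c : ℝ) (m : ℕ) : (pochPoly c m).Monic :=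
  monic_prod_of_monic _ _ (fun j _ => monic_X_add_C _)

lemma pochPoly_natDegree (c : ℝ) (m : ℕ) : (pochPoly c m).natDegree = m := by
  unfold pochPoly
  rw [natDegree_prod_of_monic _ _ (fun j _ => monic_X_add_C _)]
  simp only [natDegree_X_add_C]; simp

lemma fd_sum (c : ℝ) (n m : ℕ) (h : m ≤ n) :
    ∑ k ∈ Finset.range (n+1), (-1:ℝ)^(n-k) * (n.choose k) * poch (c + k) m
      = if m = n then (n.factorial : ℝ) else 0 := by
  have h1 := fwdDiff_iter_eq_sum_shift (1:ℝ) (pochPoly c m).eval n 0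
  have h2 : ∑ k ∈ Finset.range (n+1), (-1:ℝ)^(n-k) * (n.choose k) * poch (c + k) m
      = (fwdDiff (1:ℝ))^[n] (pochPoly c m).eval 0 := by
    rw [h1]
    refine Finset.sum_congr rfl (fun k _ => ?_)
    rw [pochPoly_eval]; simp
  rw [h2]
  split_ifs with hm
  · subst hm
    have := Polynomial.fwdDiff_iter_degree_eq_factorial (pochPoly c m)
    rw [pochPoly_natDegree, (pochPoly_monic c m).leadingCoeff] at this
    rw [this]; simp
  · rw [Polynomial.fwdDiff_iter_eq_zero_of_degree_lt (by rw [pochPoly_natDegree]; omega)]; simp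

lemma bern_span (N : ℕ) (q : ℝ[X]) (hq : q.natDegree ≤ N) :
    ∃ c : ℕ → ℝ, q = ∑ j ∈ Finset.range (N+1), C (c j) * (X^j * (1-X)^(N-j)) := by
  induction N generalizing q with
  | zero =>
    refine ⟨fun _ => q.coeff 0, ?_⟩
    simpa using eq_C_of_natDegree_le_zero hq
  | succ N ih =>
    set r := q - C (q.coeff 0) * (1-X)^(N+1) with hr
    have hd : r.natDegree ≤ N+1 := by
      refine (natDegree_sub_le _ _).trans (max_le hq ?_)
      refine (natDegree_C_mul_le _ _).trans (natDegree_pow_le_of_le (N+1) (m := 1) ?_ |>.trans (by simp))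
      exact (natDegree_sub_le _ _).trans (by simp)
    have h0 : r.coeff 0 = 0 := by
      simp [hr, coeff_zero_eq_eval_zero]
    obtain ⟨c, hc⟩ := ih r.divX (by rw [natDegree_divX_eq_natDegree_tsub_one]; omega)
    have h3 := r.divX_mul_X_add
    rw [h0, C_0, add_zero, hc] at h3
    refine ⟨fun j => if j = 0 then q.coeff 0 else c (j-1), ?_⟩
    rw [Finset.sum_range_succ']
    simp only [Nat.add_eq_zero_iff, one_ne_zero, and_false, if_false, if_true, Nat.add_sub_cancel, pow_zero, one_mul, Nat.sub_zero]
    have h4 : q = r + C (q.coeff 0) * (1-X)^(N+1) := by rw [hr]; ring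
    rw [h4, ← h3]
    congr 1
    · rw [Finset.sum_mul]
      refine Finset.sum_congr rfl (fun k _ => ?_)
      rw [Nat.add_sub_add_right, pow_succ]; ring
    · congr 2
      rw [h3, ← h4]

lemma wI_ibp {a b : ℝ} (ha : a > -1) (hb : b > -1) (p : ℝ[X]) :
    wI a b (C (b+1) * ((1-X)*p) - C (a+1) * (X * p) + X * (1-X) * derivative p) = 0 := by
  induction p using Polynomial.induction_on' with
  | add p q hp hq =>
    rw [derivative_add]
    rw [← add_zero (0:ℝ)]
    nth_rewrite 1 [← hp]
    rw [← hq, ← wI_add ha hb]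
    congr 1; ring
  | monomial m c =>
    have e : (C (b+1) * ((1-X)*(monomial m c)) - C (a+1) * (X * (monomial m c)) + X * (1-X) * derivative (monomial m c) : ℝ[X])
      = C c * (C (b+1+m) * (X^m*(1-X)^1) - C (a+1) * (X^(m+1)*(1-X)^0)) := by
      rw [derivative_monomial, ← C_mul_X_pow_eq_monomial, ← C_mul_X_pow_eq_monomial]
      rcases m with _ | m
      · simp; ring
      · simp; ring
    rw [e, wI_C_mul, wI_sub ha hb, wI_C_mul, wI_C_mul, wI_monomial ha hb, wI_monomial ha hb, poch_succ, poch_succ]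
    simp [poch_zero]
    right; ring

lemma dual_wI {n : ℕ} {α β : ℝ} {D : ℕ → ℝ[X]} (hD : IsDualBernstein n α β D)
    (j i : ℕ) (hj : j ≤ n) (hi : i ≤ n) :
    wI α β ((X^j * (1-X)^(n-j)) * D i) = if j = i then 1 / (n.choose i : ℝ) else 0 := by
  have h := hD.2 j hj i hi
  have hc : (n.choose j : ℝ) ≠ 0 := by exact_mod_cast (Nat.choose_pos hj).ne'
  have e : (∫ x in (0:ℝ)..1, (1 - x) ^ α * x ^ β * bern n j x * (D i).eval x)
      = (n.choose j : ℝ) * wI α β ((X^j * (1-X)^(n-j)) * D i) := by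
    rw [← wI_C_mul]
    unfold wI bern
    congr 1; ext x; simp; ring
  rw [e] at h
  have h2 : wI α β ((X^j * (1-X)^(n-j)) * D i) = (if j = i then (1:ℝ) else 0) / n.choose j := by
    rw [← h]; field_simp
  rw [h2]
  split_ifs with hji
  · rw [hji]
  · simp

lemma dual_coeff {n : ℕ} {α β : ℝ} (hα : α > -1) (hβ : β > -1) {D : ℕ → ℝ[X]}
    (hD : IsDualBernstein n α β D) (i : ℕ) (hi : i ≤ n) :
    (D i).coeff n = (-1)^(n-i) / (poch (α+1) (n-i) * poch (β+1) i) *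
      (Real.Gamma (α+β+2+(2*n:ℕ)) / (Real.Gamma (α+1) * Real.Gamma (β+1) * n.factorial)) := by
  set t : ℕ → ℝ := fun k => (-1)^(n-k) * (n.choose k) / (poch (α+1) (n-k) * poch (β+1) k) with ht
  set S : ℝ[X] := ∑ k ∈ Finset.range (n+1), C (t k) * (X^k * (1-X)^(n-k)) with hS
  have hpa : ∀ k, poch (α+1) k ≠ 0 := fun k => (poch_pos (by linarith) k).ne'
  have hpb : ∀ k, poch (β+1) k ≠ 0 := fun k => (poch_pos (by linarith) k).ne'
  have h1 : wI α β (S * D i) = (-1)^(n-i) / (poch (α+1) (n-i) * poch (β+1) i) := by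
    rw [hS, Finset.sum_mul, wI_sum hα hβ]
    have : ∀ k ∈ Finset.range (n+1), wI α β (C (t k) * (X^k * (1-X)^(n-k)) * D i)
        = if k = i then t k * (1 / (n.choose i : ℝ)) else 0 := by
      intro k hk
      rw [mul_assoc, wI_C_mul, dual_wI hD k i (by simpa [Nat.lt_succ_iff] using hk) hi]
      split_ifs <;> simp
    rw [Finset.sum_congr rfl this, Finset.sum_ite_eq' , if_pos (by simpa [Nat.lt_succ_iff] using hi)]
    have hc : (n.choose i : ℝ) ≠ 0 := by exact_mod_cast (Nat.choose_pos hi).ne'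
    simp only [ht]
    field_simp
  have h2 : ∀ m ≤ n, wI α β (S * X^m) = if m = n then
      Real.Gamma (α+1) * Real.Gamma (β+1) / Real.Gamma (α+β+2+(2*n:ℕ)) * n.factorial else 0 := by
    intro m hm
    have e : wI α β (S * X^m) = Real.Gamma (α+1) * Real.Gamma (β+1) / Real.Gamma (α+β+2+(n+m:ℕ)) *
      ∑ k ∈ Finset.range (n+1), (-1:ℝ)^(n-k) * (n.choose k) * poch (β + 1 + k) m := by
      rw [hS, Finset.sum_mul, wI_sum hα hβ, Finset.mul_sum]
      refine Finset.sum_congr rfl (fun k hk => ?_)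
      have hk' : k ≤ n := by simpa [Nat.lt_succ_iff] using hk
      have : C (t k) * (X^k * (1-X)^(n-k)) * X^m = C (t k) * (X^(k+m) * (1-X)^(n-k)) := by ring
      rw [this, wI_C_mul, wI_monomial hα hβ, poch_add, show k + m + (n-k) = n + m by omega]
      simp only [ht]
      have := hpa (n-k)
      have := hpb k
      field_simp
    rw [e, fd_sum _ _ _ hm]
    split_ifs with h
    · subst h; rw [two_mul]
    · simp
  have h3 : wI α β (S * D i) = (D i).coeff n *
      (Real.Gamma (α+1) * Real.Gamma (β+1) / Real.Gamma (α+β+2+(2*n:ℕ)) * n.factorial) := by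
    conv_lhs => rw [(D i).as_sum_range_C_mul_X_pow' (n := n+1) (by have := hD.1 i hi; omega)]
    rw [Finset.mul_sum, wI_sum hα hβ]
    have : ∀ m ∈ Finset.range (n+1), wI α β (S * (C ((D i).coeff m) * X^m))
        = if m = n then (D i).coeff n * (Real.Gamma (α+1) * Real.Gamma (β+1) / Real.Gamma (α+β+2+(2*n:ℕ)) * n.factorial) else 0 := by
      intro m hm
      rw [mul_left_comm, wI_C_mul, h2 m (by simpa [Nat.lt_succ_iff] using hm)]
      split_ifs with h
      · rw [h]
      · simp
    rw [Finset.sum_congr rfl this, Finset.sum_ite_eq', if_pos (by simp)]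
  rw [← h1, h3]
  have hn : (0:ℝ) ≤ (2*n:ℕ) := Nat.cast_nonneg _
  have := (Real.Gamma_pos_of_pos (show 0 < α + 1 by linarith)).ne'
  have := (Real.Gamma_pos_of_pos (show 0 < β + 1 by linarith)).ne'
  have := (Real.Gamma_pos_of_pos (show 0 < α+β+2+(2*n:ℕ) by linarith)).ne'
  have : (n.factorial : ℝ) ≠ 0 := by exact_mod_cast n.factorial_ne_zero
  field_simp

noncomputable def jacP (α β : ℝ) (k : ℕ) : ℝ[X] :=
  C (poch (α + 1) k / (Nat.factorial k)) *
    ∑ l ∈ Finset.range (k + 1),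
      C (poch (-(k : ℝ)) l * poch ((k : ℝ) + α + β + 1) l /
        (poch (α + 1) l * (Nat.factorial l))) * (1 - X) ^ l

lemma jacP_eval (α β : ℝ) (k : ℕ) (x : ℝ) : (jacP α β k).eval x = jacobiR α β k x := by
  simp only [jacP, jacobiR, eval_mul, eval_C, eval_finsetSum, eval_pow, eval_sub, eval_one, eval_X]

lemma natDegree_one_sub_pow (l : ℕ) : ((1 - X : ℝ[X])^l).natDegree ≤ l :=
  (natDegree_pow_le_of_le l (m := 1) ((natDegree_sub_le _ _).trans (by simp))).trans (by simp)

lemma coeff_one_sub_pow (n : ℕ) : ((1 - X : ℝ[X])^n).coeff n = (-1)^n := by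
  have : (1 - X : ℝ[X])^n = C ((-1)^n) * (X - C 1)^n := by
    rw [C_pow, ← mul_pow]; congr 1; simp
  rw [this, coeff_C_mul]
  have h := ((monic_X_sub_C (1:ℝ)).pow n)
  have h2 : ((X - C (1:ℝ))^n).natDegree = n := by rw [natDegree_pow, natDegree_X_sub_C, mul_one]
  have := h.coeff_natDegree
  rw [h2] at this
  rw [this, mul_one]

lemma jacP_natDegree (α β : ℝ) (k : ℕ) : (jacP α β k).natDegree ≤ k := by
  refine (natDegree_C_mul_le _ _).trans (natDegree_sum_le_of_forall_le _ _ (fun l hl => ?_))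
  exact (natDegree_C_mul_le _ _).trans ((natDegree_one_sub_pow l).trans (by simpa [Nat.lt_succ_iff] using hl))

lemma jacP_coeff {α : ℝ} (hα : α > -1) (β : ℝ) (n : ℕ) :
    (jacP α β n).coeff n = poch (n + α + β + 1) n / n.factorial := by
  rw [jacP, coeff_C_mul, finsetSum_coeff, Finset.sum_range_succ, Finset.sum_eq_zero]
  · rw [coeff_C_mul, coeff_one_sub_pow, poch_neg n n le_rfl, Nat.choose_self]
    have := (poch_pos (show 0 < α + 1 by linarith) n).ne'
    have : (n.factorial : ℝ) ≠ 0 := by exact_mod_cast n.factorial_ne_zero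
    have h : ((-1:ℝ)^n)*(-1)^n = 1 := by rw [← mul_pow]; simp
    field_simp
    push_cast
    linear_combination poch (n + α + β + 1) n * h
  · intro l hl
    rw [coeff_C_mul, coeff_eq_zero_of_natDegree_lt, mul_zero]
    exact (natDegree_one_sub_pow l).trans_lt (by simpa using hl)

lemma jacP_orth {α β : ℝ} (hα : α > -1) (hβ : β > -1) (n m : ℕ) (hm : m < n) :
    wI α β (jacP α β n * X^m) = 0 := by
  obtain ⟨k, rfl⟩ : ∃ k, n = m + 1 + k := ⟨n - (m+1), by omega⟩
  rw [jacP, mul_assoc, wI_C_mul, Finset.sum_mul, wI_sum hα hβ]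
  set n := m + 1 + k with hn
  have hs : α + β + 2 > 0 := by linarith
  have hm0 : (0:ℝ) ≤ m := m.cast_nonneg
  have hG : Real.Gamma (α+β+2+m) ≠ 0 := (Real.Gamma_pos_of_pos (by linarith)).ne'
  have hp : ∀ l, poch (α+β+2+m) l ≠ 0 := fun l => (poch_pos (by linarith) l).ne'
  have key : ∀ l ∈ Finset.range (n+1),
     wI α β (C (poch (-(n : ℝ)) l * poch ((n : ℝ) + α + β + 1) l /
        (poch (α + 1) l * (Nat.factorial l))) * (1 - X) ^ l * X^m) =
      ((-1)^n * Real.Gamma (α+1) * Real.Gamma (β+1) * poch (β+1) m / Real.Gamma (α+β+2+m) / poch (α+β+2+m) k) *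
       ((-1)^(n-l) * (n.choose l) * poch (α+β+2+m + l) k) := by
    intro l hl
    have hl' : l ≤ n := by simpa [Nat.lt_succ_iff] using hl
    rw [mul_assoc, mul_comm ((1-X)^l) (X^m), wI_C_mul, wI_monomial hα hβ, poch_neg n l hl']
    have e1 : α + β + 2 + ((m + l : ℕ):ℝ) = (α + β + 2 + m) + l := by push_cast; ring
    rw [e1, Gamma_poch (by linarith)]
    have e2 : poch (α+β+2+m) k * poch ((n : ℝ) + α + β + 1) l = poch (α+β+2+m) l * poch (α+β+2+m+l) k := by
      rw [← poch_add, add_comm l k, poch_add]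
      congr 2; rw [hn]; push_cast; ring
    have e3 : (-1:ℝ)^l = (-1)^n * (-1)^(n-l) := by
      obtain ⟨d, hd⟩ : ∃ d, n = l + d := ⟨n - l, by omega⟩
      rw [hd, Nat.add_sub_cancel_left, pow_add, mul_assoc, ← mul_pow]; simp
    have := hp l
    have := hp k
    have := (poch_pos (show 0 < α + 1 by linarith) l).ne'
    have : (l.factorial : ℝ) ≠ 0 := by exact_mod_cast l.factorial_ne_zero
    rw [e3]
    field_simp
    linear_combination (n.choose l : ℝ) * Real.Gamma (α + 1) * Real.Gamma (β + 1) * poch (β + 1) m * e2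
  rw [Finset.sum_congr rfl key, ← Finset.mul_sum, fd_sum _ _ _ (by omega), if_neg (by omega)]
  simp

lemma dual_ibp {n : ℕ} {α β : ℝ} (hα : α > -1) (hβ : β > -1) (p : ℝ[X]) (j : ℕ) (hj : j < n) :
    wI α β ((X^j * (1-X)^(n-j)) * (X * derivative p)) =
      - (β+1+j) * wI α β ((X^j * (1-X)^(n-j)) * p)
      + (α+n-j) * wI α β ((X^(j+1) * (1-X)^(n-(j+1))) * p) := by
  obtain ⟨d, rfl⟩ : ∃ d, n = j + 1 + d := ⟨n - (j+1), by omega⟩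
  have h := wI_ibp hα hβ (X^j * (1-X)^d * p)
  have e1 : j + 1 + d - j = d + 1 := by omega
  have e2 : j + 1 + d - (j + 1) = d := by omega
  rw [e1, e2]
  have e : C (β+1) * ((1-X)*(X^j * (1-X)^d * p)) - C (α+1) * (X * (X^j * (1-X)^d * p))
      + X * (1-X) * derivative (X^j * (1-X)^d * p)
      = C (β+1+j) * ((X^j * (1-X)^(d+1)) * p) - C (α+1+d) * ((X^(j+1) * (1-X)^d) * p)
        + (X^j * (1-X)^(d+1)) * (X * derivative p) := by
    have hx : (X : ℝ[X]) * derivative (X^j : ℝ[X]) = C (j:ℝ) * X^j := by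
      rcases j with _ | j
      · simp
      · simp [derivative_X_pow]; ring
    have hy : (1 - X : ℝ[X]) * derivative ((1-X)^d : ℝ[X]) = - C (d:ℝ) * (1-X)^d := by
      rcases d with _ | d
      · simp
      · simp [derivative_pow]; ring
    rw [derivative_mul, derivative_mul]
    simp only [C_add, C_1]
    linear_combination (1 - X) * (1-X)^d * p * hx + X * X^j * p * hy
  rw [e, wI_add hα hβ, wI_sub hα hβ, wI_C_mul, wI_C_mul] at h
  push_cast
  linear_combination h

lemma final_coeff {n i : ℕ} {α β : ℝ} (hα : α > -1) (hβ : β > -1) (hi : i ≤ n)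
    {D : ℕ → ℝ[X]} (hD : IsDualBernstein n α β D) :
    ((n:ℝ) + i + β + 1) * (D i).coeff n
      - ((i:ℝ)*((n:ℝ)-i+α+1)/((n:ℝ)-i+1)) * (D (i-1)).coeff n
    = ((-1)^(n-i) * ((n:ℝ)+1) * poch (α+β+2) n /
      ((Real.Gamma (α+1) * Real.Gamma (β+1) / Real.Gamma (α+β+2)) * poch (α+1) (n-i) * poch (β+1) i)) * (((n:ℝ)+β+1)/((n:ℝ)-i+1)) * (jacP (α+1) β n).coeff n := by
  have g1 := (Real.Gamma_pos_of_pos (show 0 < α + 1 by linarith)).ne'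
  have g2 := (Real.Gamma_pos_of_pos (show 0 < β + 1 by linarith)).ne'
  have g3 := (Real.Gamma_pos_of_pos (show 0 < α + β + 2 by linarith)).ne'
  have hf : (n.factorial : ℝ) ≠ 0 := by exact_mod_cast n.factorial_ne_zero
  have hpa : ∀ k, poch (α+1) k ≠ 0 := fun k => (poch_pos (by linarith) k).ne'
  have hpb : ∀ k, poch (β+1) k ≠ 0 := fun k => (poch_pos (by linarith) k).ne'
  have hG : Real.Gamma (α+β+2+(2*n:ℕ)) = poch (α+β+2) n * poch (α+β+2+n) n * Real.Gamma (α+β+2) := by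
    rw [Gamma_poch (by linarith), two_mul, poch_add]
  have e1 : (n:ℝ) + (α+1) + β + 1 = α+β+2+n := by ring
  rw [jacP_coeff (by linarith), dual_coeff hα hβ hD i hi, dual_coeff hα hβ hD (i-1) (by omega), hG, e1]
  have hni : (n:ℝ) - i + 1 ≠ 0 := by
    have : (i:ℝ) ≤ n := by exact_mod_cast hi
    linarith
  rcases i with _ | i
  · have := hpa n
    simp at hni ⊢
    simp only [poch_zero]
    field_simp
  · obtain ⟨d, rfl⟩ : ∃ d, n = i + 1 + d := ⟨n - (i+1), by omega⟩
    have d1 : i + 1 + d - (i+1) = d := by omega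
    have d2 : i + 1 + d - (i+1-1) = d+1 := by omega
    rw [d1, d2, Nat.add_sub_cancel, poch_succ, poch_succ, pow_succ]
    have := hpa d
    have := hpb i
    have : α + 1 + d ≠ 0 := by have := d.cast_nonneg (α := ℝ); linarith
    have : β + 1 + i ≠ 0 := by have := i.cast_nonneg (α := ℝ); linarith
    have q1 : ((i + 1 + d : ℕ) : ℝ) - ((i+1:ℕ):ℝ) = d := by push_cast; ring
    rw [q1] at hni ⊢
    rw [show (d:ℝ) + α + 1 = α + 1 + d by ring]
    field_simp
    push_cast
    ring

/-- Differential-recurrence relation as an identity of polynomials. -/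
lemma diffRec_poly {n i : ℕ} {α β : ℝ} (hα : α > -1) (hβ : β > -1) (hi : i ≤ n)
    {D : ℕ → ℝ[X]} (hD : IsDualBernstein n α β D) (c A : ℝ)
    (hc : c = ((i:ℝ)*((n:ℝ)-i+α+1)/((n:ℝ)-i+1)))
    (hA : ((n:ℝ) + i + β + 1) * (D i).coeff n - c * (D (i-1)).coeff n
      = A * (jacP (α+1) β n).coeff n) :
    X * derivative (D i) + C (i+β+1) * D i - C c * D (i-1) - C A * jacP (α+1) β n = 0 := by
  set P := X * derivative (D i) + C (i+β+1) * D i - C c * D (i-1) with hP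
  set Q := P - C A * jacP (α+1) β n with hQ
  have hα1 : α + 1 > -1 := by linarith
  have hdi := hD.1 i hi
  have hdi' := hD.1 (i-1) (by omega)
  have hQn : Q.natDegree ≤ n := by
    refine (natDegree_sub_le _ _).trans (max_le ?_ ((natDegree_C_mul_le _ _).trans (jacP_natDegree _ _ _)))
    refine (natDegree_sub_le _ _).trans (max_le ?_ ((natDegree_C_mul_le _ _).trans hdi'))
    refine (natDegree_add_le _ _).trans (max_le ?_ ((natDegree_C_mul_le _ _).trans hdi))
    rw [natDegree_le_iff_coeff_eq_zero]
    intro N hN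
    rcases N with _ | N
    · omega
    · rw [coeff_X_mul, coeff_derivative, coeff_eq_zero_of_natDegree_lt (by omega), zero_mul]
  have hQc : Q.coeff n = 0 := by
    have : (X * derivative (D i)).coeff n = n * (D i).coeff n := by
      rcases n with _ | n
      · simp
      · rw [coeff_X_mul, coeff_derivative]; push_cast; ring
    simp only [hQ, hP, coeff_sub, coeff_add, coeff_C_mul, this]
    linear_combination hA
  -- orthogonality of Q to all polynomials of degree < n
  have orth : ∀ j < n, wI α β ((X^j * (1-X)^(n-j)) * P) = 0 := by
    intro j hj
    have e : (X^j * (1-X)^(n-j)) * P = (X^j * (1-X)^(n-j)) * (X * derivative (D i))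
       + C (i+β+1) * ((X^j * (1-X)^(n-j)) * D i) - C c * ((X^j * (1-X)^(n-j)) * D (i-1)) := by
      rw [hP]; ring
    rw [e, wI_sub hα hβ, wI_add hα hβ, wI_C_mul, wI_C_mul, dual_ibp hα hβ _ j hj,
      dual_wI hD j i hj.le hi, dual_wI hD j (i-1) hj.le (by omega), dual_wI hD (j+1) i hj hi]
    rcases i with _ | i
    · simp only [hc]
      rcases Nat.eq_zero_or_pos j with h | h
      · subst h; simp
      · simp [h.ne']
    · simp only [Nat.add_right_cancel_iff, Nat.add_sub_cancel]
      by_cases h : j = i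
      · subst h
        simp only [Nat.left_eq_add, one_ne_zero, if_false, if_true]
        have hch : (n.choose (j+1) : ℝ) * (j+1) = n.choose j * ((n:ℝ) - j) := by
          rw [← Nat.cast_sub (by omega)]; exact_mod_cast Nat.choose_succ_right_eq n j
        have h1 : (n.choose (j+1) : ℝ) ≠ 0 := by exact_mod_cast (Nat.choose_pos hj).ne'
        have h2 : (n.choose j : ℝ) ≠ 0 := by exact_mod_cast (Nat.choose_pos hj.le).ne'
        have h3 : (n:ℝ) - j ≠ 0 := by
          have : (j:ℝ) < n := by exact_mod_cast hj
          linarith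
        rw [hc]
        have h4 : (n:ℝ) - ((j+1:ℕ):ℝ) + 1 = n - j := by push_cast; ring
        rw [h4, show (n:ℝ) - ((j+1:ℕ):ℝ) + α + 1 = n - j + α by push_cast; ring]
        field_simp
        push_cast
        linear_combination (-(α + n - j)) * hch
      · simp only [h, if_false]
        split_ifs with h'
        · subst h'; push_cast; ring
        · ring
  have orthQ : ∀ q : ℝ[X], (∀ k, n ≤ k → q.coeff k = 0) → wI (α+1) β (Q * q) = 0 := by
    intro q hq
    rcases Nat.eq_zero_or_pos n with h0 | hpos
    · have : q = 0 := by ext k; rw [hq k (by omega)]; simp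
      simp [this, wI]
    have hqd : q.natDegree ≤ n - 1 := by
      rw [natDegree_le_iff_coeff_eq_zero]; intro N hN; exact hq N (by omega)
    have eJ : wI (α+1) β (jacP (α+1) β n * q) = 0 := by
      rw [q.as_sum_range_C_mul_X_pow' (n := n) (by omega), Finset.mul_sum, wI_sum hα1 hβ]
      refine Finset.sum_eq_zero (fun m hm => ?_)
      rw [mul_left_comm, wI_C_mul, jacP_orth hα1 hβ n m (by simpa using hm), mul_zero]
    have eP : wI (α+1) β (P * q) = 0 := by
      obtain ⟨b, hb⟩ := bern_span (n-1) q hqd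
      rw [wI_succ, hb, Finset.mul_sum, Finset.mul_sum, wI_sum hα hβ]
      refine Finset.sum_eq_zero (fun j hj => ?_)
      have hj' : j < n := by simp at hj; omega
      have : (1 - X) * (P * (C (b j) * (X^j * (1-X)^(n-1-j)))) = C (b j) * ((X^j * (1-X)^(n-j)) * P) := by
        rw [show n - j = n - 1 - j + 1 by omega, pow_succ]; ring
      rw [this, wI_C_mul, orth j hj', mul_zero]
    rw [hQ, sub_mul, mul_assoc, wI_sub hα1 hβ, wI_C_mul, eP, eJ]; simp
  apply wI_eq_zero hα1 hβ
  apply orthQ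
  intro k hk
  rcases hk.eq_or_lt with rfl | hk
  · exact hQc
  · exact coeff_eq_zero_of_natDegree_lt (by omega)

/-- Differential-recurrence relation (Theorem 3.3 of the paper). -/
theorem dualBernstein_diffRec_II (n : ℕ) (α β : ℝ) (hα : α > -1) (hβ : β > -1)
    (D : ℕ → Polynomial ℝ) (hD : IsDualBernstein n α β D)
    (i : ℕ) (hi : i ≤ n) (x : ℝ) :
    x * (Polynomial.derivative (D i)).eval x + ((i:ℝ)+β+1) * (D i).eval x
      = ((i:ℝ)*((n:ℝ)-i+α+1)/((n:ℝ)-i+1)) * (D (i-1)).eval x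
        + ((-1)^(n-i) * ((n:ℝ)+1) * poch (α+β+2) n /
      ((Real.Gamma (α+1) * Real.Gamma (β+1) / Real.Gamma (α+β+2)) * poch (α+1) (n-i) * poch (β+1) i)) * (((n:ℝ)+β+1)/((n:ℝ)-i+1)) * jacobiR (α+1) β n x := by
  have h := diffRec_poly hα hβ hi hD _ _ rfl (final_coeff hα hβ hi hD)
  have h2 := congrArg (Polynomial.eval x) h
  simp only [eval_sub, eval_add, eval_mul, eval_C, eval_X, eval_zero, jacP_eval] at h2
  linear_combination h2
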